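/- arXiv:2409.11943 — 2 statements merged into one kernel-verified Lean document; each statement's English description precedes it below -/
import Mathlib

section
/- Let d ≥ 1. For all f, g ∈ 𝒮(ℝ^{2d+1}) one has | ∫_{ℝ^{2d+1}} (∂f/∂t)(z,t) · conj(g(z,t)) dz dt | ≤ (1/4) ( ‖X₁ f‖_{L²} ‖Y₁ g‖_{L²} + ‖Y₁ f‖_{L²} ‖X₁ g‖_{L²} ) ≤ (1/2) ‖∇_H f‖_{L²} ‖∇_H g‖_{L²}, where the middle bound follows from the commutator identity ∂/∂t = (1/4)(Y₁X₁ − X₁Y₁). -/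
noncomputable section

open MeasureTheory ENNReal

/-- The Heisenberg group ℍ^d modeled on ℝ^d × ℝ^d × ℝ. -/
abbrev Hd (d : ℕ) : Type := EuclideanSpace ℝ (Fin d) × EuclideanSpace ℝ (Fin d) × ℝ

/-- The left-invariant vector field `X_j = ∂_{x_j} + 2 y_j ∂_t`. -/
def Xop (d : ℕ) (j : Fin d) (f : Hd d → ℂ) (p : Hd d) : ℂ :=
  fderiv ℝ f p (EuclideanSpace.single j 1, 0, 2 * p.2.1 j)

/-- The left-invariant vector field `Y_j = ∂_{y_j} - 2 x_j ∂_t`. -/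
def Yop (d : ℕ) (j : Fin d) (f : Hd d → ℂ) (p : Hd d) : ℂ :=
  fderiv ℝ f p (0, EuclideanSpace.single j 1, -(2 * p.1 j))

/-- The vertical derivative `T = ∂_t`. -/
def Tder (d : ℕ) (f : Hd d → ℂ) (p : Hd d) : ℂ :=
  fderiv ℝ f p (0, 0, 1)

/-- The rotation operator `N = Σ_j (y_j ∂_{x_j} - x_j ∂_{y_j})`. -/
def Nop (d : ℕ) (f : Hd d → ℂ) (p : Hd d) : ℂ :=
  fderiv ℝ f p (p.2.1, -p.1, 0)

/-- The sublaplacian `Δ_H = Σ_j (X_j² + Y_j²)`. -/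
def subLap (d : ℕ) (f : Hd d → ℂ) (p : Hd d) : ℂ :=
  ∑ j : Fin d, (Xop d j (Xop d j f) p + Yop d j (Yop d j f) p)

/-- Squared length of the horizontal gradient: `|∇_H f|² = Σ_j (|X_j f|² + |Y_j f|²)`. -/
def gradHsq (d : ℕ) (f : Hd d → ℂ) (p : Hd d) : ℝ :=
  ∑ j : Fin d, (‖Xop d j f p‖ ^ 2 + ‖Yop d j f p‖ ^ 2)

/-- `|z|² = |x|² + |y|²`. -/
def zsq (d : ℕ) (p : Hd d) : ℝ := ‖p.1‖ ^ 2 + ‖p.2.1‖ ^ 2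

/-- `|z|`. -/
def zn (d : ℕ) (p : Hd d) : ℝ := Real.sqrt (zsq d p)

/-- The weight `w₁(z,t) = |z| (1+|z|²)^{-1/2} (1 + (|z|⁴+t²)^{1/2})⁻¹`. -/
def w1 (d : ℕ) (p : Hd d) : ℝ :=
  zn d p / Real.sqrt (1 + zn d p ^ 2) / (1 + Real.sqrt (zn d p ^ 4 + p.2.2 ^ 2))

/-- The weight `w₂(z,t) = (1+|z|²+t²)^{-1/2}`. -/
def w2 (d : ℕ) (p : Hd d) : ℝ :=
  (Real.sqrt (1 + zsq d p + p.2.2 ^ 2))⁻¹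

/-- The weight `w₄(z,t) = |z| (|z|⁴+t²)^{-1/2}`. -/
def w4 (d : ℕ) (p : Hd d) : ℝ :=
  zn d p / Real.sqrt (zn d p ^ 4 + p.2.2 ^ 2)

/-- The `L²` norm over `ℝ^{2d+1}` of a complex-valued function. -/
def L2norm (d : ℕ) (h : Hd d → ℂ) : ℝ := Real.sqrt (∫ p, ‖h p‖ ^ 2)

section HelperLemmas

open SchwartzMap LineDeriv

variable {E : Type*} [NormedAddCommGroup E] [NormedSpace ℝ E]

/-- The first order operator `∂_v + ℓ ∂_w` on Schwartz functions, where `ℓ` is a continuous linear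
functional acting by multiplication. -/
def affineDeriv (ℓ : E →L[ℝ] ℝ) (v w : E) (f : SchwartzMap E ℂ) : SchwartzMap E ℂ :=
  ∂_{v} f + smulLeftCLM ℂ ℓ (∂_{w} f)

theorem affineDeriv_apply (ℓ : E →L[ℝ] ℝ) (v w : E) (f : SchwartzMap E ℂ) (p : E) :
    affineDeriv ℓ v w f p = fderiv ℝ f p (v + ℓ p • w) := by
  simp [affineDeriv, smulLeftCLM_apply_apply ℓ.hasTemperateGrowth, lineDerivOp_apply_eq_fderiv]

/-- The Leibniz rule for multiplication by a continuous linear functional. -/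
theorem lineDerivOp_smulLeftCLM_clm (ℓ : E →L[ℝ] ℝ) (v : E) (f : SchwartzMap E ℂ) :
    ∂_{v} (smulLeftCLM ℂ ℓ f) = ℓ v • f + smulLeftCLM ℂ ℓ (∂_{v} f) := by
  ext p
  have h : HasFDerivAt (fun x => ℓ x • f x)
      (ℓ p • fderiv ℝ f p + ContinuousLinearMap.smulRight ℓ (f p)) p :=
    ℓ.hasFDerivAt.smul (f.hasFDerivAt p)
  rw [lineDerivOp_apply_eq_fderiv, smulLeftCLM_apply ℓ.hasTemperateGrowth, h.fderiv]
  simp [smulLeftCLM_apply_apply ℓ.hasTemperateGrowth, lineDerivOp_apply_eq_fderiv, add_comm]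

theorem lineDerivOp_comm_schwartz (v w : E) (f : SchwartzMap E ℂ) :
    ∂_{v} (∂_{w} f) = ∂_{w} (∂_{v} f) := by
  have h (v w : E) (p : E) : ∂_{v} (∂_{w} f) p = fderiv ℝ (fderiv ℝ f) p v w := by
    have hd : HasFDerivAt (∂_{w} f : SchwartzMap E ℂ) ((fderiv ℝ (fderiv ℝ f) p).flip w) p := by
      have := ((fderivCLM ℝ E ℂ f).differentiableAt (x := p)).hasFDerivAt.clm_apply
        (hasFDerivAt_const w p)
      simpa [funext (lineDerivOp_apply_eq_fderiv w f), funext (fderivCLM_apply ℝ f)] using this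
    rw [lineDerivOp_apply_eq_fderiv, hd.fderiv, ContinuousLinearMap.flip_apply]
  ext p
  rw [h, h]
  exact ((f.smooth 2).contDiffAt.isSymmSndFDerivAt (by simp)).eq v w

/-- The commutator of two operators `∂_v + ℓ ∂_w` whose functionals do not see the directions
`w`. -/
theorem affineDeriv_commutator {ℓ₁ ℓ₂ : E →L[ℝ] ℝ} {v₁ v₂ w₁ w₂ : E} (h₁ : ℓ₁ w₂ = 0)
    (h₂ : ℓ₂ w₁ = 0) (f : SchwartzMap E ℂ) :
    affineDeriv ℓ₁ v₁ w₁ (affineDeriv ℓ₂ v₂ w₂ f) - affineDeriv ℓ₂ v₂ w₂ (affineDeriv ℓ₁ v₁ w₁ f) =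
      ℓ₂ v₁ • ∂_{w₂} f - ℓ₁ v₂ • ∂_{w₁} f := by
  simp only [affineDeriv, lineDerivOp_add, lineDerivOp_smulLeftCLM_clm, h₁, h₂, map_add, zero_smul,
    zero_add, smulLeftCLM_smulLeftCLM_apply ℓ₁.hasTemperateGrowth ℓ₂.hasTemperateGrowth,
    smulLeftCLM_smulLeftCLM_apply ℓ₂.hasTemperateGrowth ℓ₁.hasTemperateGrowth,
    lineDerivOp_comm_schwartz v₂ v₁, lineDerivOp_comm_schwartz w₂ w₁,
    lineDerivOp_comm_schwartz v₂ w₁, lineDerivOp_comm_schwartz w₂ v₁, mul_comm (ℓ₂ : E → ℝ) ℓ₁]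
  abel

/-- The real bilinear map `(a, b) ↦ a * conj b` on `ℂ`. -/
def mulConjCLM : ℂ →L[ℝ] ℂ →L[ℝ] ℂ :=
  (ContinuousLinearMap.mul ℝ ℂ).bilinearComp (ContinuousLinearMap.id ℝ ℂ)
    (Complex.conjCLE : ℂ →L[ℝ] ℂ)

theorem mulConjCLM_apply (a b : ℂ) : mulConjCLM a b = a * (starRingEnd ℂ) b := rfl

variable [MeasurableSpace E] [BorelSpace E] [FiniteDimensional ℝ E] {μ : Measure E}
  [μ.IsAddHaarMeasure]

theorem integrable_mul_conj_schwartz (f g : SchwartzMap E ℂ) :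
    Integrable (fun p => f p * (starRingEnd ℂ) (g p)) μ :=
  (bilinLeftCLM mulConjCLM g.hasTemperateGrowth f).integrable

theorem integral_lineDerivOp_mul_conj (v : E) (f g : SchwartzMap E ℂ) :
    ∫ p, (∂_{v} f) p * (starRingEnd ℂ) (g p) ∂μ =
      -∫ p, f p * (starRingEnd ℂ) ((∂_{v} g) p) ∂μ := by
  have := integral_bilinear_lineDerivOp_right_eq_neg_left (μ := μ) f g mulConjCLM v
  simp only [mulConjCLM_apply] at this
  rw [this, neg_neg]

/-- `∂_v + ℓ ∂_w` is skew-symmetric when `ℓ w = 0`. -/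
theorem integral_affineDeriv_mul_conj {ℓ : E →L[ℝ] ℝ} {v w : E} (h : ℓ w = 0)
    (f g : SchwartzMap E ℂ) :
    ∫ p, affineDeriv ℓ v w f p * (starRingEnd ℂ) (g p) ∂μ =
      -∫ p, f p * (starRingEnd ℂ) (affineDeriv ℓ v w g p) ∂μ := by
  have hw : smulLeftCLM ℂ ℓ (∂_{w} f) = ∂_{w} (smulLeftCLM ℂ ℓ f) := by
    simp [lineDerivOp_smulLeftCLM_clm, h]
  have hmove (p : E) : smulLeftCLM ℂ ℓ f p * (starRingEnd ℂ) ((∂_{w} g) p) =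
      f p * (starRingEnd ℂ) (smulLeftCLM ℂ ℓ (∂_{w} g) p) := by
    simp only [smulLeftCLM_apply_apply ℓ.hasTemperateGrowth, Complex.real_smul, map_mul,
      Complex.conj_ofReal]
    ring
  simp only [affineDeriv, hw, add_apply, map_add, add_mul, mul_add]
  rw [integral_add (integrable_mul_conj_schwartz _ _) (integrable_mul_conj_schwartz _ _),
    integral_add (integrable_mul_conj_schwartz _ _) (integrable_mul_conj_schwartz _ _),
    integral_lineDerivOp_mul_conj, integral_lineDerivOp_mul_conj]
  simp only [hmove]
  ring

theorem integrable_norm_sq_schwartz (f : SchwartzMap E ℂ) : Integrable (fun p => ‖f p‖ ^ 2) μ := by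
  simpa [Complex.mul_conj'] using (integrable_mul_conj_schwartz (μ := μ) f f).norm

/-- The Cauchy-Schwarz inequality for Schwartz functions. -/
theorem norm_integral_mul_conj_le_schwartz (f g : SchwartzMap E ℂ) :
    ‖∫ p, f p * (starRingEnd ℂ) (g p) ∂μ‖ ≤
      Real.sqrt (∫ p, ‖f p‖ ^ 2 ∂μ) * Real.sqrt (∫ p, ‖g p‖ ^ 2 ∂μ) := by
  have h := integral_mul_norm_le_Lp_mul_Lq (μ := μ) Real.HolderConjugate.two_two
    (f.memLp (ENNReal.ofReal 2) μ) (g.memLp (ENNReal.ofReal 2) μ)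
  simp only [Real.rpow_two, ← Real.sqrt_eq_rpow] at h
  refine (norm_integral_le_integral_norm _).trans ?_
  simpa using h

end HelperLemmas

instance isAddHaarMeasure_volume_Hd (d : ℕ) : (volume : Measure (Hd d)).IsAddHaarMeasure :=
  haveI : (volume : Measure (EuclideanSpace ℝ (Fin d) × ℝ)).IsAddHaarMeasure :=
    Measure.prod.instIsAddHaarMeasure volume volume
  Measure.prod.instIsAddHaarMeasure volume volume

/-- `X_j` as an operator on Schwartz functions. -/
def schwartzX (d : ℕ) (j : Fin d) (f : SchwartzMap (Hd d) ℂ) : SchwartzMap (Hd d) ℂ :=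
  affineDeriv (EuclideanSpace.proj j ∘L ContinuousLinearMap.fst ℝ _ ℝ ∘L
    ContinuousLinearMap.snd ℝ (EuclideanSpace ℝ (Fin d)) _)
    (EuclideanSpace.single j 1, 0, 0) (0, 0, 2) f

/-- `Y_j` as an operator on Schwartz functions. -/
def schwartzY (d : ℕ) (j : Fin d) (f : SchwartzMap (Hd d) ℂ) : SchwartzMap (Hd d) ℂ :=
  affineDeriv (EuclideanSpace.proj j ∘L ContinuousLinearMap.fst ℝ (EuclideanSpace ℝ (Fin d)) _)
    (0, EuclideanSpace.single j 1, 0) (0, 0, -2) f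

theorem coe_schwartzX (d : ℕ) (j : Fin d) (f : SchwartzMap (Hd d) ℂ) :
    ⇑(schwartzX d j f) = Xop d j f := by
  ext p
  simp [schwartzX, affineDeriv_apply, Xop, mul_comm]

theorem coe_schwartzY (d : ℕ) (j : Fin d) (f : SchwartzMap (Hd d) ℂ) :
    ⇑(schwartzY d j f) = Yop d j f := by
  ext p
  simp [schwartzY, affineDeriv_apply, Yop, mul_comm]

/-- The commutator identity `4 ∂_t = Y_j X_j - X_j Y_j`. -/
theorem Tder_eq_commutator (d : ℕ) (j : Fin d) (f : SchwartzMap (Hd d) ℂ) (p : Hd d) :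
    Tder d f p = (1 / 4) * (schwartzY d j (schwartzX d j f) p -
      schwartzX d j (schwartzY d j f) p) := by
  have hvec (c : ℝ) : ((0, 0, c) : Hd d) = c • (0, 0, 1) := by simp
  rw [← sub_apply, schwartzY, schwartzX, schwartzX, schwartzY,
    affineDeriv_commutator (by simp) (by simp)]
  simp [SchwartzMap.lineDerivOp_apply_eq_fderiv, hvec 2, hvec (-2), Tder, -Prod.smul_mk]
  ring

theorem integral_Tder_mul_conj (d : ℕ) (j : Fin d) (f g : SchwartzMap (Hd d) ℂ) :
    ∫ p, Tder d f p * (starRingEnd ℂ) (g p) =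
      (1 / 4) * ((∫ p, schwartzY d j f p * (starRingEnd ℂ) (schwartzX d j g p)) -
        ∫ p, schwartzX d j f p * (starRingEnd ℂ) (schwartzY d j g p)) := by
  have hX (u : SchwartzMap (Hd d) ℂ) : ∫ p, schwartzX d j u p * (starRingEnd ℂ) (g p) =
      -∫ p, u p * (starRingEnd ℂ) (schwartzX d j g p) :=
    integral_affineDeriv_mul_conj (by simp) u g
  have hY (u : SchwartzMap (Hd d) ℂ) : ∫ p, schwartzY d j u p * (starRingEnd ℂ) (g p) =
      -∫ p, u p * (starRingEnd ℂ) (schwartzY d j g p) :=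
    integral_affineDeriv_mul_conj (by simp) u g
  simp only [Tder_eq_commutator d j, mul_assoc, sub_mul]
  rw [integral_const_mul, integral_sub (integrable_mul_conj_schwartz _ _)
    (integrable_mul_conj_schwartz _ _), hX, hY]
  ring

theorem integrable_norm_sq_Xop (d : ℕ) (j : Fin d) (f : SchwartzMap (Hd d) ℂ) :
    Integrable (fun p => ‖Xop d j f p‖ ^ 2) := by
  simpa only [coe_schwartzX] using integrable_norm_sq_schwartz (μ := volume) (schwartzX d j f)

theorem integrable_norm_sq_Yop (d : ℕ) (j : Fin d) (f : SchwartzMap (Hd d) ℂ) :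
    Integrable (fun p => ‖Yop d j f p‖ ^ 2) := by
  simpa only [coe_schwartzY] using integrable_norm_sq_schwartz (μ := volume) (schwartzY d j f)

theorem integrable_gradHsq (d : ℕ) (f : SchwartzMap (Hd d) ℂ) : Integrable (gradHsq d f) :=
  integrable_finsetSum _ fun j _ => (integrable_norm_sq_Xop d j f).add (integrable_norm_sq_Yop d j f)

theorem norm_sq_add_norm_sq_le_gradHsq (d : ℕ) (j : Fin d) (f : Hd d → ℂ) (p : Hd d) :
    ‖Xop d j f p‖ ^ 2 + ‖Yop d j f p‖ ^ 2 ≤ gradHsq d f p :=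
  Finset.single_le_sum (f := fun j => ‖Xop d j f p‖ ^ 2 + ‖Yop d j f p‖ ^ 2)
    (fun _ _ => by positivity) (Finset.mem_univ j)

theorem L2norm_Xop_le (d : ℕ) (j : Fin d) (f : SchwartzMap (Hd d) ℂ) :
    L2norm d (Xop d j f) ≤ Real.sqrt (∫ p, gradHsq d f p) :=
  Real.sqrt_le_sqrt <| integral_mono (integrable_norm_sq_Xop d j f) (integrable_gradHsq d f)
    fun p => (le_add_of_nonneg_right (by positivity)).trans (norm_sq_add_norm_sq_le_gradHsq d j f p)

theorem L2norm_Yop_le (d : ℕ) (j : Fin d) (f : SchwartzMap (Hd d) ℂ) :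
    L2norm d (Yop d j f) ≤ Real.sqrt (∫ p, gradHsq d f p) :=
  Real.sqrt_le_sqrt <| integral_mono (integrable_norm_sq_Yop d j f) (integrable_gradHsq d f)
    fun p => (le_add_of_nonneg_left (by positivity)).trans (norm_sq_add_norm_sq_le_gradHsq d j f p)

/-- For Schwartz `f, g`,
`|∫ (∂f/∂t) conj(g)| ≤ ¼ (‖X₁f‖ ‖Y₁g‖ + ‖Y₁f‖ ‖X₁g‖) ≤ ½ ‖∇_H f‖ ‖∇_H g‖`,
where all norms are `L²` norms (the middle bound coming from `∂_t = ¼(Y₁X₁ - X₁Y₁)`). -/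
theorem vertical_derivative_bilinear_bound (d : ℕ) (hd : 1 ≤ d)
    (f g : SchwartzMap (Hd d) ℂ) :
    ‖∫ p, Tder d (⇑f) p * (starRingEnd ℂ) (g p)‖ ≤
        (1/4) * (L2norm d (Xop d ⟨0, hd⟩ (⇑f)) * L2norm d (Yop d ⟨0, hd⟩ (⇑g)) +
          L2norm d (Yop d ⟨0, hd⟩ (⇑f)) * L2norm d (Xop d ⟨0, hd⟩ (⇑g))) ∧
      (1/4) * (L2norm d (Xop d ⟨0, hd⟩ (⇑f)) * L2norm d (Yop d ⟨0, hd⟩ (⇑g)) +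
          L2norm d (Yop d ⟨0, hd⟩ (⇑f)) * L2norm d (Xop d ⟨0, hd⟩ (⇑g))) ≤
        (1/2) * (Real.sqrt (∫ p, gradHsq d (⇑f) p) * Real.sqrt (∫ p, gradHsq d (⇑g) p)) := by
  have hL (h : Hd d → ℂ) : 0 ≤ L2norm d h := Real.sqrt_nonneg _
  constructor
  · have h₁ := norm_integral_mul_conj_le_schwartz (μ := volume) (schwartzY d ⟨0, hd⟩ f)
      (schwartzX d ⟨0, hd⟩ g)
    have h₂ := norm_integral_mul_conj_le_schwartz (μ := volume) (schwartzX d ⟨0, hd⟩ f)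
      (schwartzY d ⟨0, hd⟩ g)
    rw [integral_Tder_mul_conj d ⟨0, hd⟩, norm_mul]
    simp only [coe_schwartzX, coe_schwartzY] at h₁ h₂ ⊢
    have h := norm_sub_le_of_le h₁ h₂
    have h4 : ‖(1 / 4 : ℂ)‖ = 1 / 4 := by norm_num
    rw [h4]
    simp only [L2norm]
    linarith
  · have h₁ := mul_le_mul (L2norm_Xop_le d ⟨0, hd⟩ f) (L2norm_Yop_le d ⟨0, hd⟩ g) (hL _)
      (Real.sqrt_nonneg _)
    have h₂ := mul_le_mul (L2norm_Yop_le d ⟨0, hd⟩ f) (L2norm_Xop_le d ⟨0, hd⟩ g) (hL _)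
      (Real.sqrt_nonneg _)
    linarith
end
end

section
/- Let d ≥ 1. For every f ∈ 𝒮(ℝ^{2d+1}) one has the subordination estimate ‖∂f/∂t‖_{L²(ℝ^{2d+1})} ≤ (1/2) ‖Δ_H f‖_{L²(ℝ^{2d+1})}. -/
noncomputable section

open MeasureTheory ENNReal

section FourierSide

open SchwartzMap LineDeriv FourierTransform

variable {V : Type*} [NormedAddCommGroup V] [InnerProductSpace ℝ V]

lemma hasTemperateGrowth_inner (m : V) : (fun v : V ↦ inner ℝ v m).HasTemperateGrowth := by
  fun_prop

/-- The field `∂_a + 2 s ⟨b, ·⟩ ∂_τ` acting on Schwartz functions. -/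
def horizField (τ a b : V) (s : ℝ) (f : SchwartzMap V ℂ) : SchwartzMap V ℂ :=
  ∂_{a} f + (2 * s) • smulLeftCLM ℂ (fun v : V ↦ inner ℝ v b) (∂_{τ} f)

/-- The operator corresponding to `horizField τ a b s` on the Fourier side. -/
def horizSymbol (τ a b : V) (s : ℝ) (g : SchwartzMap V ℂ) : SchwartzMap V ℂ :=
  (2 * Real.pi * Complex.I) • smulLeftCLM ℂ (fun v : V ↦ inner ℝ v a) g -
    (2 * s) • smulLeftCLM ℂ (fun v : V ↦ inner ℝ v τ) (∂_{b} g)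

lemma horizField_apply (τ a b : V) (s : ℝ) (f : SchwartzMap V ℂ) (v : V) :
    horizField τ a b s f v = fderiv ℝ f v (a + (2 * s * inner ℝ v b) • τ) := by
  simp [horizField, smulLeftCLM_apply_apply (hasTemperateGrowth_inner _),
    lineDerivOp_apply_eq_fderiv]
  ring

lemma horizSymbol_apply (τ a b : V) (s : ℝ) (g : SchwartzMap V ℂ) (v : V) :
    horizSymbol τ a b s g v = (2 * Real.pi * Complex.I) * (inner ℝ v a * g v) -
      (2 * s) * (inner ℝ v τ * ∂_{b} g v) := by
  simp [horizSymbol, smulLeftCLM_apply_apply (hasTemperateGrowth_inner _)]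

lemma lineDerivOp_smulLeftCLM_inner (τ b : V) (g : SchwartzMap V ℂ) (v : V) :
    ∂_{b} (smulLeftCLM ℂ (fun v : V ↦ inner ℝ v τ) g) v =
      inner ℝ b τ * g v + inner ℝ v τ * ∂_{b} g v := by
  have h1 : HasFDerivAt (fun v : V ↦ (inner ℝ v τ : ℝ)) ((innerSL ℝ).flip τ) v :=
    ((innerSL ℝ).flip τ).hasFDerivAt
  have h2 : HasFDerivAt (fun v ↦ (inner ℝ v τ : ℝ) • g v) _ v := h1.smul (g.hasFDerivAt v)
  rw [lineDerivOp_apply_eq_fderiv, smulLeftCLM_apply (hasTemperateGrowth_inner _), h2.fderiv,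
    lineDerivOp_apply_eq_fderiv]
  simp [innerSL_apply_apply ℝ, real_inner_comm]
  ring

lemma lineDerivOp_horizSymbol (τ a b c : V) (s : ℝ) (hc : inner ℝ c τ = 0)
    (g : SchwartzMap V ℂ) (v : V) :
    ∂_{c} (horizSymbol τ a b s g) v =
      (2 * Real.pi * Complex.I) * (inner ℝ c a * g v + inner ℝ v a * ∂_{c} g v) -
      (2 * s) * (inner ℝ v τ * ∂_{c} (∂_{b} g) v) := by
  have : ∂_{c} (horizSymbol τ a b s g) =
      (2 * Real.pi * Complex.I) • ∂_{c} (smulLeftCLM ℂ (fun v : V ↦ inner ℝ v a) g) -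
    (2 * s) • ∂_{c} (smulLeftCLM ℂ (fun v : V ↦ inner ℝ v τ) (∂_{b} g)) := by
    rw [horizSymbol, sub_eq_add_neg, lineDerivOp_add, lineDerivOp_neg, lineDerivOp_smul,
      lineDerivOp_smul, sub_eq_add_neg]
  simp [this, lineDerivOp_smulLeftCLM_inner, hc]

lemma lineDerivOp_swap (a b : V) (g : SchwartzMap V ℂ) (v : V) :
    ∂_{a} (∂_{b} g) v = ∂_{b} (∂_{a} g) v := by
  have key : ∀ a b : V, (∂_{a} (∂_{b} g) : SchwartzMap V ℂ) v = fderiv ℝ (fderiv ℝ g) v a b := by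
    intro a b
    have hd : DifferentiableAt ℝ (fderiv ℝ g) v :=
      ((g.smooth 2).fderiv_right (m := 1) (by norm_num)).differentiable (by norm_num) v
    rw [lineDerivOp_apply_eq_fderiv]
    have : ⇑(∂_{b} g : SchwartzMap V ℂ) = fun w ↦ fderiv ℝ g w b := by
      ext w; rw [lineDerivOp_apply_eq_fderiv]
    rw [this, fderiv_clm_apply hd (differentiableAt_const _)]
    simp
  rw [key, key]
  exact ((g.smooth 2).contDiffAt.isSymmSndFDerivAt (by simp)) a b

/-- The commutation relation `[X, Y] = -4 ∂_t` on the Fourier side. -/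
lemma horizSymbol_commutator {τ a b : V} (haτ : inner ℝ a τ = 0) (hbτ : inner ℝ b τ = 0)
    (haa : inner ℝ a a = 1) (hbb : inner ℝ b b = 1) (g : SchwartzMap V ℂ) (v : V) :
    horizSymbol τ a b 1 (horizSymbol τ b a (-1) g) v -
      horizSymbol τ b a (-1) (horizSymbol τ a b 1 g) v =
      -((8 * Real.pi * inner ℝ v τ : ℝ) : ℂ) * (Complex.I * g v) := by
  rw [horizSymbol_apply τ a b, horizSymbol_apply τ b a (-1) (horizSymbol τ a b 1 g),
    lineDerivOp_horizSymbol _ _ _ _ _ hbτ, lineDerivOp_horizSymbol _ _ _ _ _ haτ,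
    horizSymbol_apply, horizSymbol_apply, haa, hbb, lineDerivOp_swap a b]
  push_cast
  ring

lemma horizSymbol_I_smul (τ a b : V) (s : ℝ) (g : SchwartzMap V ℂ) (v : V) :
    horizSymbol τ a b s (Complex.I • g) v = Complex.I * horizSymbol τ a b s g v := by
  simp [horizSymbol_apply, lineDerivOp_smul]
  ring

variable [FiniteDimensional ℝ V] [MeasurableSpace V] [BorelSpace V]

lemma fourier_horizField {τ b : V} (a : V) (s : ℝ) (hbτ : inner ℝ b τ = 0)
    (f : SchwartzMap V ℂ) : 𝓕 (horizField τ a b s f) = horizSymbol τ a b s (𝓕 f) := by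
  have hc : (2 * Real.pi * Complex.I) ≠ 0 := Complex.two_pi_I_ne_zero
  have h := lineDerivOp_fourier_eq (∂_{τ} f) b
  have h2 : 𝓕 (smulLeftCLM ℂ (fun v : V ↦ inner ℝ v b) (∂_{τ} f)) =
      -smulLeftCLM ℂ (fun v : V ↦ inner ℝ v τ) (∂_{b} (𝓕 f)) := by
    rw [fourier_lineDerivOp_eq, lineDerivOp_smul, fourier_smul, neg_smul,
      ← smul_neg] at h
    have h3 := smul_right_injective _ hc h
    ext v
    have h4 := congrArg (fun u : SchwartzMap V ℂ ↦ u v) h3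
    simp only [lineDerivOp_smulLeftCLM_inner, hbτ] at h4
    simp only [_root_.neg_apply, smulLeftCLM_apply_apply (hasTemperateGrowth_inner _)] at h4 ⊢
    rw [eq_comm, neg_eq_iff_eq_neg] at h4
    simp [h4]
  rw [horizField, horizSymbol, FourierAdd.fourier_add, fourier_lineDerivOp_eq, fourier_smul, h2,
    smul_neg, sub_eq_add_neg]

/-- A continuous function dominated by a product of two Schwartz functions is integrable. -/
lemma integrable_of_norm_le_mul {E : Type*} [NormedAddCommGroup E] {F : V → E} (hF : Continuous F)
    (u w : SchwartzMap V ℂ) (h : ∀ v, ‖F v‖ ≤ ‖u v‖ * ‖w v‖) : Integrable F := by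
  have h1 : Integrable (fun v ↦ ‖u v‖ * ‖w v‖) :=
    (u.memLp 2).norm.integrable_mul (w.memLp 2).norm
  exact h1.mono' hF.aestronglyMeasurable (Filter.Eventually.of_forall h)

lemma integral_mul_inner_lineDerivOp (τ b : V) (hbτ : inner ℝ b τ = 0) {φ : ℝ → ℝ}
    (hφ : Continuous φ) (hφ' : ∀ r, |φ r| ≤ |r|) (g h : SchwartzMap V ℂ) :
    ∫ v, φ (inner ℝ v τ) * inner ℝ v τ * inner ℝ (g v) (∂_{b} h v) =
      -∫ v, φ (inner ℝ v τ) * inner ℝ v τ * inner ℝ (∂_{b} g v) (h v) := by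
  set T := fun v : V ↦ (inner ℝ v τ : ℝ)
  have hT : Continuous T := by fun_prop
  have hint : ∀ g h : SchwartzMap V ℂ,
      Integrable (fun v ↦ innerSL ℝ ((φ (T v) * T v) • g v) (h v)) := by
    intro g h
    refine integrable_of_norm_le_mul ?_ (smulLeftCLM ℂ T g) (smulLeftCLM ℂ T h) fun v ↦ ?_
    · have := g.continuous
      have := h.continuous
      simp only [innerSL_apply_apply ℝ]
      fun_prop
    · simp only [smulLeftCLM_apply_apply (hasTemperateGrowth_inner τ), innerSL_apply_apply ℝ, T]
      refine (norm_inner_le_norm _ _).trans ?_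
      simp only [norm_smul, Real.norm_eq_abs, abs_mul]
      have := hφ' (inner ℝ v τ)
      calc _ ≤ |(inner ℝ v τ : ℝ)| * |(inner ℝ v τ : ℝ)| * ‖g v‖ * ‖h v‖ := by gcongr
        _ = _ := by ring
  have key := integral_bilinear_hasLineDerivAt_right_eq_neg_left_of_integrable (μ := volume)
    (f := fun v ↦ (φ (T v) * T v) • g v)
    (f' := fun v ↦ (φ (T v) * T v) • (∂_{b} g : SchwartzMap V ℂ) v)
    (g := h) (g' := (∂_{b} h : SchwartzMap V ℂ)) (v := b) (B := innerSL ℝ)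
    (hint _ _) (hint _ _) (hint _ _) ?_ ?_
  · simpa only [innerSL_apply_apply ℝ, real_inner_smul_left] using key
  · intro v _
    have hTv : ∀ r : ℝ, T (v + r • b) = T v := by
      intro r; simp [T, inner_add_left, inner_smul_left, hbτ]
    have h1 : HasLineDerivAt ℝ g (∂_{b} g v) v b := by
      rw [lineDerivOp_apply_eq_fderiv]
      exact (g.hasFDerivAt v).hasLineDerivAt b
    unfold HasLineDerivAt at h1 ⊢
    simp only [hTv]
    exact HasDerivAt.fun_const_smul _ h1
  · intro v _
    rw [lineDerivOp_apply_eq_fderiv]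
    exact (h.hasFDerivAt v).hasLineDerivAt b

lemma integrable_mul_inner (τ : V) {φ : ℝ → ℝ} (hφ : Continuous φ) (hφ' : ∀ r, |φ r| ≤ |r|)
    (g h : SchwartzMap V ℂ) : Integrable (fun v ↦ φ (inner ℝ v τ) * inner ℝ (g v) (h v)) := by
  refine integrable_of_norm_le_mul ?_ (smulLeftCLM ℂ (fun v : V ↦ inner ℝ v τ) g) h fun v ↦ ?_
  · have := g.continuous
    have := h.continuous
    fun_prop
  · simp only [smulLeftCLM_apply_apply (hasTemperateGrowth_inner τ), norm_mul, norm_smul]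
    rw [mul_assoc]
    exact mul_le_mul (hφ' _) (norm_inner_le_norm _ _) (norm_nonneg _) (norm_nonneg _)

/-- Skew-adjointness of `horizSymbol` with respect to weights depending only on `⟨·, τ⟩`. -/
lemma integral_mul_inner_horizSymbol {τ b : V} (a : V) (s : ℝ) (hbτ : inner ℝ b τ = 0) {φ : ℝ → ℝ}
    (hφ : Continuous φ) (hφ' : ∀ r, |φ r| ≤ |r|) (g h : SchwartzMap V ℂ) :
    ∫ v, φ (inner ℝ v τ) * inner ℝ (horizSymbol τ a b s g v) (h v) =
      -∫ v, φ (inner ℝ v τ) * inner ℝ (g v) (horizSymbol τ a b s h v) := by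
  have hi := integrable_mul_inner τ hφ hφ'
  have key := integral_mul_inner_lineDerivOp τ b hbτ hφ hφ' g h
  let M (g : SchwartzMap V ℂ) := smulLeftCLM ℂ (fun v : V ↦ inner ℝ v τ) g
  have e1 : ∀ v, φ (inner ℝ v τ) * inner ℝ (horizSymbol τ a b s g v) (h v) +
      φ (inner ℝ v τ) * inner ℝ (g v) (horizSymbol τ a b s h v) =
      -(2 * s) * (φ (inner ℝ v τ) * inner ℝ v τ * inner ℝ (∂_{b} g v) (h v)) +
      -(2 * s) * (φ (inner ℝ v τ) * inner ℝ v τ * inner ℝ (g v) (∂_{b} h v)) := by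
    intro v
    rw [horizSymbol_apply, horizSymbol_apply]
    simp [Complex.inner]
    ring
  have i1 : Integrable fun v ↦ φ (inner ℝ v τ) * inner ℝ v τ * inner ℝ (∂_{b} g v) (h v) := by
    convert hi (M (∂_{b} g)) h using 2 with v
    simp [M, smulLeftCLM_apply_apply (hasTemperateGrowth_inner τ), Complex.inner]
    ring
  have i2 : Integrable fun v ↦ φ (inner ℝ v τ) * inner ℝ v τ * inner ℝ (g v) (∂_{b} h v) := by
    convert hi (M g) (∂_{b} h) using 2 with v
    simp [M, smulLeftCLM_apply_apply (hasTemperateGrowth_inner τ), Complex.inner]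
    ring
  rw [eq_neg_iff_add_eq_zero, ← integral_add (hi _ _) (hi _ _)]
  simp_rw [e1]
  rw [integral_add (i1.const_mul _) (i2.const_mul _), integral_const_mul, integral_const_mul, key]
  ring

/-- The spectral lower bound for one pair of fields, with the weight `|⟨·, τ⟩|`. -/
lemma integral_inner_sq_le {τ a b : V} (haτ : inner ℝ a τ = 0) (hbτ : inner ℝ b τ = 0)
    (haa : inner ℝ a a = 1) (hbb : inner ℝ b b = 1) (g : SchwartzMap V ℂ) :
    8 * Real.pi * ∫ v, inner ℝ v τ ^ 2 * ‖g v‖ ^ 2 ≤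
      -∫ v, |(inner ℝ v τ : ℝ)| * inner ℝ (horizSymbol τ a b 1 (horizSymbol τ a b 1 g) v +
        horizSymbol τ b a (-1) (horizSymbol τ b a (-1) g) v) (g v) := by
  set X := horizSymbol τ a b 1
  set Y := horizSymbol τ b a (-1)
  have hIX : ∀ v, X (Complex.I • g) v = Complex.I * X g v := horizSymbol_I_smul _ _ _ _ _
  have hIY : ∀ v, Y (Complex.I • g) v = Complex.I * Y g v := horizSymbol_I_smul _ _ _ _ _
  have hiA := integrable_mul_inner τ (φ := fun r ↦ |r|) (by fun_prop) (by simp)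
  have hi := integrable_mul_inner τ (φ := fun r ↦ r) (by fun_prop) (by simp)
  have sX := integral_mul_inner_horizSymbol a 1 hbτ (φ := fun r ↦ r) (by fun_prop) (by simp)
    (Y g) (Complex.I • g)
  have sY := integral_mul_inner_horizSymbol b (-1) haτ (φ := fun r ↦ r) (by fun_prop) (by simp)
    (X g) (Complex.I • g)
  have aX := integral_mul_inner_horizSymbol a 1 hbτ (φ := fun r ↦ |r|) (by fun_prop) (by simp)
    (X g) g
  have aY := integral_mul_inner_horizSymbol b (-1) haτ (φ := fun r ↦ |r|) (by fun_prop) (by simp)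
    (Y g) g
  have e1 : 8 * Real.pi * ∫ v, inner ℝ v τ ^ 2 * ‖g v‖ ^ 2 =
      ∫ v, (inner ℝ v τ * inner ℝ (Y (X g) v) ((Complex.I • g) v) -
        inner ℝ v τ * inner ℝ (X (Y g) v) ((Complex.I • g) v)) := by
    rw [← integral_const_mul]
    congr 1 with v
    have hc := horizSymbol_commutator haτ hbτ haa hbb g v
    rw [← mul_sub, ← inner_sub_left, ← neg_sub (X (Y g) v), hc, neg_mul, neg_neg]
    have : (Complex.I • g) v = Complex.I * g v := by simp
    rw [this, ← Complex.real_smul, inner_smul_left, real_inner_self_eq_norm_sq]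
    simp
    ring
  have e2 : -∫ v, |(inner ℝ v τ : ℝ)| * inner ℝ (X (X g) v + Y (Y g) v) (g v) =
      ∫ v, (|(inner ℝ v τ : ℝ)| * inner ℝ (X g v) (X g v) +
        |(inner ℝ v τ : ℝ)| * inner ℝ (Y g v) (Y g v)) := by
    simp_rw [inner_add_left, mul_add]
    rw [integral_add (hiA _ _) (hiA _ _), integral_add (hiA _ _) (hiA _ _), aX, aY]
    ring
  rw [e1, e2, integral_sub (hi _ _) (hi _ _), sX, sY, sub_neg_eq_add, neg_add_eq_sub,
    ← integral_sub (hi _ _) (hi _ _)]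
  refine integral_mono ((hi _ _).sub (hi _ _)) ((hiA _ _).add (hiA _ _)) fun v ↦ ?_
  simp only
  have n1 := abs_real_inner_le_norm (Y g v) (X (Complex.I • g) v)
  have n2 := abs_real_inner_le_norm (X g v) (Y (Complex.I • g) v)
  rw [hIX, norm_mul, Complex.norm_I, one_mul] at n1
  rw [hIY, norm_mul, Complex.norm_I, one_mul] at n2
  rw [← mul_sub, ← mul_add, real_inner_self_eq_norm_sq, real_inner_self_eq_norm_sq, hIX, hIY]
  refine (le_abs_self _).trans ?_
  rw [abs_mul]
  refine mul_le_mul_of_nonneg_left ((abs_sub _ _).trans ?_) (abs_nonneg _)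
  nlinarith [sq_nonneg (‖X g v‖ - ‖Y g v‖)]

/-- The sublaplacian on the Fourier side controls multiplication by `⟨·, τ⟩`. -/
lemma integral_inner_sq_le_integral_sublaplacian {ι : Type*} [Fintype ι] [Nonempty ι] {τ : V}
    {a b : ι → V} (haτ : ∀ j, inner ℝ (a j) τ = 0) (hbτ : ∀ j, inner ℝ (b j) τ = 0)
    (haa : ∀ j, inner ℝ (a j) (a j) = 1) (hbb : ∀ j, inner ℝ (b j) (b j) = 1)
    (g : SchwartzMap V ℂ) :
    64 * Real.pi ^ 2 * ∫ v, inner ℝ v τ ^ 2 * ‖g v‖ ^ 2 ≤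
      ∫ v, ‖(∑ j, (horizSymbol τ (a j) (b j) 1 (horizSymbol τ (a j) (b j) 1 g) +
        horizSymbol τ (b j) (a j) (-1) (horizSymbol τ (b j) (a j) (-1) g))) v‖ ^ 2 := by
  set L := fun j ↦ horizSymbol τ (a j) (b j) 1 (horizSymbol τ (a j) (b j) 1 g) +
        horizSymbol τ (b j) (a j) (-1) (horizSymbol τ (b j) (a j) (-1) g)
  have hpi := Real.pi_pos
  set A := ∫ v, inner ℝ v τ ^ 2 * ‖g v‖ ^ 2
  have hA : 0 ≤ A := integral_nonneg fun v ↦ by positivity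
  have hiA := integrable_mul_inner τ (φ := fun r ↦ |r|) (by fun_prop) (by simp)
  have h1 : 8 * Real.pi * A ≤ -∫ v, |(inner ℝ v τ : ℝ)| * inner ℝ ((∑ j, L j) v) (g v) := by
    have hj : ∀ j, 8 * Real.pi * A ≤ -∫ v, |(inner ℝ v τ : ℝ)| * inner ℝ (L j v) (g v) :=
      fun j ↦ integral_inner_sq_le (haτ j) (hbτ j) (haa j) (hbb j) g
    simp_rw [_root_.sum_apply, sum_inner, Finset.mul_sum]
    rw [integral_finsetSum _ fun j _ ↦ hiA _ _, ← Finset.sum_neg_distrib]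
    obtain ⟨i⟩ := ‹Nonempty ι›
    exact (hj i).trans (Finset.single_le_sum
      (f := fun j ↦ -∫ v, |(inner ℝ v τ : ℝ)| * inner ℝ (L j v) (g v))
      (fun j _ ↦ le_trans (by positivity) (hj j)) (Finset.mem_univ i))
  have iA : Integrable fun v : V ↦ (inner ℝ v τ : ℝ) ^ 2 * ‖g v‖ ^ 2 := by
    have hM := smulLeftCLM_apply_apply (hasTemperateGrowth_inner τ) g
    refine integrable_of_norm_le_mul ?_ (smulLeftCLM ℂ (fun v : V ↦ inner ℝ v τ) g)
      (smulLeftCLM ℂ (fun v : V ↦ inner ℝ v τ) g) fun v ↦ ?_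
    · have := g.continuous
      fun_prop
    · simp only [hM, norm_mul, norm_smul, norm_pow, norm_norm]
      exact le_of_eq (by ring)
  have iB : Integrable fun v : V ↦ ‖(∑ j, L j) v‖ ^ 2 :=
    integrable_of_norm_le_mul (by have := (∑ j, L j).continuous; fun_prop) (∑ j, L j) (∑ j, L j)
      fun v ↦ by simp [sq]
  have h2 : -∫ v, |(inner ℝ v τ : ℝ)| * inner ℝ ((∑ j, L j) v) (g v) ≤
      (1 / (16 * Real.pi)) * (∫ v, ‖(∑ j, L j) v‖ ^ 2) + 4 * Real.pi * A := by
    rw [← integral_neg, ← integral_const_mul, ← integral_const_mul,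
      ← integral_add (iB.const_mul _) (iA.const_mul _)]
    refine integral_mono (hiA _ _).neg ((iB.const_mul _).add (iA.const_mul _)) fun v ↦ ?_
    have n1 := abs_real_inner_le_norm ((∑ j, L j) v) (g v)
    set p := ‖(∑ j, L j) v‖
    set t := |(inner ℝ v τ : ℝ)| with ht
    calc -(t * inner ℝ ((∑ j, L j) v) (g v)) ≤ t * (p * ‖g v‖) := by
          rw [← mul_neg]
          exact mul_le_mul_of_nonneg_left ((neg_le_abs _).trans n1) (abs_nonneg _)
      _ ≤ (1 / (16 * Real.pi)) * p ^ 2 + 4 * Real.pi * (t ^ 2 * ‖g v‖ ^ 2) := by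
          have : (1 / (16 * Real.pi)) * p ^ 2 + 4 * Real.pi * (t ^ 2 * ‖g v‖ ^ 2) -
            t * (p * ‖g v‖) = (p - 8 * Real.pi * (t * ‖g v‖)) ^ 2 / (16 * Real.pi) := by
              field_simp
              ring
          have : 0 ≤ (p - 8 * Real.pi * (t * ‖g v‖)) ^ 2 / (16 * Real.pi) := by positivity
          linarith
      _ = _ := by rw [ht, sq_abs]
  have h3 : 4 * Real.pi * A ≤ (1 / (16 * Real.pi)) * (∫ v, ‖(∑ j, L j) v‖ ^ 2) := by linarith
  rw [one_div_mul_eq_div, le_div_iff₀ (by positivity)] at h3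
  linarith

/-- The subordination estimate on an inner product space. -/
lemma integral_norm_sq_lineDerivOp_le {ι : Type*} [Fintype ι] [Nonempty ι] {τ : V}
    {a b : ι → V} (haτ : ∀ j, inner ℝ (a j) τ = 0) (hbτ : ∀ j, inner ℝ (b j) τ = 0)
    (haa : ∀ j, inner ℝ (a j) (a j) = 1) (hbb : ∀ j, inner ℝ (b j) (b j) = 1)
    (f : SchwartzMap V ℂ) :
    16 * ∫ v, ‖∂_{τ} f v‖ ^ 2 ≤
      ∫ v, ‖(∑ j, (horizField τ (a j) (b j) 1 (horizField τ (a j) (b j) 1 f) +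
        horizField τ (b j) (a j) (-1) (horizField τ (b j) (a j) (-1) f))) v‖ ^ 2 := by
  have h := integral_inner_sq_le_integral_sublaplacian haτ hbτ haa hbb (𝓕 f)
  rw [← integral_norm_sq_fourier (∂_{τ} f), ← integral_norm_sq_fourier (∑ j, _)]
  have h1 : ∀ v, ‖𝓕 (∂_{τ} f) v‖ ^ 2 = 4 * Real.pi ^ 2 * (inner ℝ v τ ^ 2 * ‖𝓕 f v‖ ^ 2) := by
    intro v
    rw [fourier_lineDerivOp_eq]
    simp only [_root_.smul_apply, smulLeftCLM_apply_apply (hasTemperateGrowth_inner τ),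
      norm_smul, mul_pow, norm_mul, Complex.norm_I, Complex.norm_real, Complex.norm_ofNat,
      Real.norm_eq_abs, sq_abs]
    ring
  have h2 : 𝓕 (∑ j, (horizField τ (a j) (b j) 1 (horizField τ (a j) (b j) 1 f) +
        horizField τ (b j) (a j) (-1) (horizField τ (b j) (a j) (-1) f))) =
      ∑ j, (horizSymbol τ (a j) (b j) 1 (horizSymbol τ (a j) (b j) 1 (𝓕 f)) +
        horizSymbol τ (b j) (a j) (-1) (horizSymbol τ (b j) (a j) (-1) (𝓕 f))) := by
    rw [← fourierCLM_apply (R := ℂ), map_sum]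
    refine Finset.sum_congr rfl fun j _ ↦ ?_
    rw [fourierCLM_apply, FourierAdd.fourier_add, fourier_horizField _ _ (hbτ j),
      fourier_horizField _ _ (hbτ j),
      fourier_horizField _ _ (haτ j), fourier_horizField _ _ (haτ j)]
  rw [h2]
  simp_rw [h1]
  rw [integral_const_mul]
  linarith

end FourierSide

section Transport

open SchwartzMap LineDeriv

/-- `ℝ^d × ℝ^d × ℝ` with its Euclidean structure. -/
abbrev EuclideanHd (d : ℕ) : Type :=
  WithLp 2 (EuclideanSpace ℝ (Fin d) × WithLp 2 (EuclideanSpace ℝ (Fin d) × ℝ))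

/-- The identity from `EuclideanHd d` to `Hd d`. -/
def euclideanEquiv (d : ℕ) : EuclideanHd d ≃L[ℝ] Hd d :=
  (WithLp.prodContinuousLinearEquiv 2 ℝ _ _).trans
    ((ContinuousLinearEquiv.refl ℝ _).prodCongr (WithLp.prodContinuousLinearEquiv 2 ℝ _ _))

lemma exists_integral_eq_mul_integral_euclideanEquiv (d : ℕ) :
    ∃ c : ℝ, 0 ≤ c ∧ ∀ F : Hd d → ℝ, ∫ p, F p = c * ∫ v, F (euclideanEquiv d v) := by
  have : (volume : Measure (Hd d)).IsAddHaarMeasure :=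
    have : (volume : Measure (EuclideanSpace ℝ (Fin d) × ℝ)).IsAddHaarMeasure :=
      Measure.prod.instIsAddHaarMeasure _ _
    Measure.prod.instIsAddHaarMeasure _ _
  let μ : Measure (Hd d) := Measure.map (euclideanEquiv d) volume
  have hμ : μ.IsAddHaarMeasure := (euclideanEquiv d).isAddHaarMeasure_map _
  refine ⟨Measure.addHaarScalarFactor volume μ, NNReal.coe_nonneg _, fun F ↦ ?_⟩
  have h := Measure.isAddLeftInvariant_eq_smul (volume : Measure (Hd d)) μ
  conv_lhs => rw [h]
  rw [integral_smul_nnreal_measure]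
  have := (euclideanEquiv d).toHomeomorph.measurableEmbedding.integral_map (μ := volume) F
  simp only [ContinuousLinearEquiv.coe_toHomeomorph] at this
  rw [NNReal.smul_def, smul_eq_mul, this]

variable {d : ℕ}

lemma fderiv_euclideanEquiv (φ : Hd d → ℂ) (v w : EuclideanHd d) :
    fderiv ℝ φ (euclideanEquiv d v) (euclideanEquiv d w) =
      fderiv ℝ (φ ∘ euclideanEquiv d) v w := by
  rw [ContinuousLinearEquiv.comp_right_fderiv]
  rfl

/-- The unit vector of the `x_j` axis. -/
def xVec (j : Fin d) : EuclideanHd d := (euclideanEquiv d).symm (EuclideanSpace.single j 1, 0, 0)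

/-- The unit vector of the `y_j` axis. -/
def yVec (j : Fin d) : EuclideanHd d := (euclideanEquiv d).symm (0, EuclideanSpace.single j 1, 0)

/-- The unit vector of the `t` axis. -/
def tVec (d : ℕ) : EuclideanHd d := (euclideanEquiv d).symm (0, 0, 1)

lemma inner_euclideanEquiv_symm (v : EuclideanHd d) (p : Hd d) :
    inner ℝ v ((euclideanEquiv d).symm p) =
      inner ℝ (euclideanEquiv d v).1 p.1 + inner ℝ (euclideanEquiv d v).2.1 p.2.1 +
        (euclideanEquiv d v).2.2 * p.2.2 := by
  rw [WithLp.prod_inner_apply, WithLp.prod_inner_apply, ← add_assoc,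
    real_inner_comm ((euclideanEquiv d).symm p).ofLp.2.ofLp.2]
  rfl

lemma Xop_euclideanEquiv (j : Fin d) (φ : Hd d → ℂ) (g : SchwartzMap (EuclideanHd d) ℂ)
    (hg : φ ∘ euclideanEquiv d = g) :
    Xop d j φ ∘ euclideanEquiv d = horizField (tVec d) (xVec j) (yVec j) 1 g := by
  ext v
  rw [horizField_apply, ← hg, ← fderiv_euclideanEquiv, Function.comp_apply, Xop]
  congr 1
  rw [yVec, inner_euclideanEquiv_symm]
  simp [xVec, tVec, EuclideanSpace.inner_single_right]

lemma Yop_euclideanEquiv (j : Fin d) (φ : Hd d → ℂ) (g : SchwartzMap (EuclideanHd d) ℂ)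
    (hg : φ ∘ euclideanEquiv d = g) :
    Yop d j φ ∘ euclideanEquiv d = horizField (tVec d) (yVec j) (xVec j) (-1) g := by
  ext v
  rw [horizField_apply, ← hg, ← fderiv_euclideanEquiv, Function.comp_apply, Yop]
  congr 1
  rw [xVec, inner_euclideanEquiv_symm]
  simp [yVec, tVec, EuclideanSpace.inner_single_right]

end Transport

/-- Subordination estimate `‖∂f/∂t‖_{L²} ≤ ½ ‖Δ_H f‖_{L²}` for Schwartz `f`. -/
theorem vertical_derivative_subordinate (d : ℕ) (hd : 1 ≤ d) (f : SchwartzMap (Hd d) ℂ) :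
    Real.sqrt (∫ p, ‖Tder d (⇑f) p‖ ^ 2) ≤
      (1/2) * Real.sqrt (∫ p, ‖subLap d (⇑f) p‖ ^ 2) := by
  obtain ⟨c, hc, hint⟩ := exists_integral_eq_mul_integral_euclideanEquiv d
  have : Nonempty (Fin d) := ⟨⟨0, hd⟩⟩
  set g : SchwartzMap (EuclideanHd d) ℂ :=
    SchwartzMap.compCLMOfContinuousLinearEquiv ℂ (euclideanEquiv d) f
  have hg : f ∘ euclideanEquiv d = g := rfl
  have key := integral_norm_sq_lineDerivOp_le (τ := tVec d) (a := xVec) (b := yVec)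
    (fun j ↦ by rw [tVec, inner_euclideanEquiv_symm]; simp [xVec])
    (fun j ↦ by rw [tVec, inner_euclideanEquiv_symm]; simp [yVec])
    (fun j ↦ by rw [xVec, inner_euclideanEquiv_symm]; simp)
    (fun j ↦ by rw [yVec, inner_euclideanEquiv_symm]; simp) g
  have hT : ∀ v, Tder d f (euclideanEquiv d v) = LineDeriv.lineDerivOp (tVec d) g v := by
    intro v
    rw [SchwartzMap.lineDerivOp_apply_eq_fderiv, ← hg, ← fderiv_euclideanEquiv, Tder]
    simp [tVec]
  have hL : ∀ v, subLap d f (euclideanEquiv d v) =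
      (∑ j, (horizField (tVec d) (xVec j) (yVec j) 1 (horizField (tVec d) (xVec j) (yVec j) 1 g) +
        horizField (tVec d) (yVec j) (xVec j) (-1)
          (horizField (tVec d) (yVec j) (xVec j) (-1) g))) v := by
    intro v
    rw [subLap, _root_.sum_apply]
    refine Finset.sum_congr rfl fun j _ ↦ congrArg₂ (· + ·) ?_ ?_
    · exact congrFun (Xop_euclideanEquiv j _ _ (Xop_euclideanEquiv j _ _ hg)) v
    · exact congrFun (Yop_euclideanEquiv j _ _ (Yop_euclideanEquiv j _ _ hg)) v
  rw [hint, hint]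
  simp_rw [hT, hL]
  have h2 : (1 / 2 : ℝ) = Real.sqrt (1 / 4) := by
    rw [show (1 / 4 : ℝ) = (1 / 2) ^ 2 by norm_num, Real.sqrt_sq (by norm_num)]
  rw [h2, ← Real.sqrt_mul (by norm_num)]
  apply Real.sqrt_le_sqrt
  rw [mul_left_comm]
  refine mul_le_mul_of_nonneg_left ?_ hc
  have : 0 ≤ ∫ v, ‖LineDeriv.lineDerivOp (tVec d) g v‖ ^ 2 := integral_nonneg fun v ↦ sq_nonneg _
  linarith
end
end
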